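/- arXiv:2203.02754 — 3 statements merged into one kernel-verified Lean document; each statement's English description precedes it below -/
import Mathlib

section
/- Greedy row selection achieves a (1 − 1/e) approximation of the maximal cell coverage for a fixed column set: if g : ℕ → Finset α satisfies g 0 = ∅ and for each j, g (j+1) = insert (x j) (g j) where x j maximizes the coverage after insertion (i.e., for every row y, f(insert y (g j)) ≤ f(insert (x j) (g j))), then for every k and every finite row set S with S.card ≤ k, (f (g k) : ℝ) ≥ (1 − (1 − 1/k)^k) · f S, and in particular (f (g k) : ℝ) ≥ (1 − Real.exp (−1)) · f S. -/
/-- Cell coverage: the number of cells (row, column pairs) of the full table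
described by some association rule covered by the selected row set `S`. -/
def cellCov {α β ι : Type*} [Fintype ι] [DecidableEq α] [DecidableEq β] [DecidableEq ι]
    (rows : ι → Finset α) (cols : ι → Finset β) (S : Finset α) : ℕ :=
  ((Finset.univ.filter (fun i => ((rows i) ∩ S).Nonempty)).biUnion
      (fun i => rows i ×ˢ cols i)).card

/-- The cells described by a rule holding at row `y`. -/
def rowCells {α β ι : Type*} [Fintype ι] [DecidableEq α] [DecidableEq β] [DecidableEq ι]
    (rows : ι → Finset α) (cols : ι → Finset β) (y : α) : Finset (α × β) :=
  (Finset.univ.filter (fun i => y ∈ rows i)).biUnion (fun i => rows i ×ˢ cols i)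

theorem cellCov_eq {α β ι : Type*} [Fintype ι] [DecidableEq α] [DecidableEq β] [DecidableEq ι]
    (rows : ι → Finset α) (cols : ι → Finset β) (S : Finset α) :
    cellCov rows cols S = (S.biUnion (rowCells rows cols)).card := by
  unfold cellCov
  congr 1
  ext p
  simp only [rowCells, Finset.mem_biUnion, Finset.mem_filter, Finset.mem_univ, true_and,
    Finset.Nonempty, Finset.mem_inter]
  constructor
  · rintro ⟨i, ⟨y, hy, hS⟩, hp⟩
    exact ⟨y, hS, i, hy, hp⟩
  · rintro ⟨y, hS, i, hy, hp⟩
    exact ⟨i, ⟨y, hy, hS⟩, hp⟩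

theorem cellCov_step {α β ι : Type*} [Fintype ι] [DecidableEq α] [DecidableEq β] [DecidableEq ι]
    (rows : ι → Finset α) (cols : ι → Finset β) (S G : Finset α) (m k : ℕ) (hS : S.card ≤ k)
    (hm : ∀ y, cellCov rows cols (insert y G) ≤ cellCov rows cols G + m) :
    cellCov rows cols S ≤ cellCov rows cols G + k * m := by
  simp only [cellCov_eq] at *
  set A := rowCells rows cols
  have h1 : ∀ y, (A y \ G.biUnion A).card ≤ m := by
    intro y
    have h := hm y
    rw [Finset.biUnion_insert, ← Finset.card_sdiff_add_card] at h
    omega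
  have h2 : S.biUnion A ⊆ G.biUnion A ∪ S.biUnion (fun y => A y \ G.biUnion A) := by
    intro p hp
    by_cases hG : p ∈ G.biUnion A
    · exact Finset.mem_union_left _ hG
    · obtain ⟨y, hy, hpy⟩ := Finset.mem_biUnion.1 hp
      exact Finset.mem_union_right _
        (Finset.mem_biUnion.2 ⟨y, hy, Finset.mem_sdiff.2 ⟨hpy, hG⟩⟩)
  have h3 := Finset.card_le_card h2
  have h4 := Finset.card_union_le (G.biUnion A) (S.biUnion (fun y => A y \ G.biUnion A))
  have h5 := Finset.card_biUnion_le_card_mul S (fun y => A y \ G.biUnion A) m (fun y _ => h1 y)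
  have h6 := Nat.mul_le_mul_right m hS
  omega

/-- Greedy row selection achieves a `(1 - 1/e)` approximation of the maximal
cell coverage (for a fixed column set). -/
theorem greedy_cellCov_approx {α β ι : Type*} [Fintype α] [Fintype β] [Fintype ι]
    [DecidableEq α] [DecidableEq β] [DecidableEq ι]
    (rows : ι → Finset α) (cols : ι → Finset β)
    (g : ℕ → Finset α) (x : ℕ → α)
    (hg0 : g 0 = ∅)
    (hgreedy : ∀ j : ℕ, g (j + 1) = insert (x j) (g j) ∧
      ∀ y : α, cellCov rows cols (insert y (g j)) ≤
        cellCov rows cols (insert (x j) (g j))) :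
    ∀ k : ℕ, ∀ S : Finset α, S.card ≤ k →
      ((cellCov rows cols (g k) : ℝ) ≥
          (1 - (1 - 1 / (k : ℝ)) ^ k) * (cellCov rows cols S : ℝ)) ∧
      ((cellCov rows cols (g k) : ℝ) ≥
          (1 - Real.exp (-1)) * (cellCov rows cols S : ℝ)) := by
  intro k S hS
  rcases Nat.eq_zero_or_pos k with rfl | hk
  · have hS0 : S = ∅ := by simpa using hS
    subst hS0
    simp [cellCov_eq]
  have hk' : (1 : ℝ) ≤ k := by exact_mod_cast hk
  have hr : 0 ≤ 1 - 1 / (k : ℝ) := by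
    rw [sub_nonneg, div_le_one (by linarith)]
    exact hk'
  have key : ∀ j : ℕ, (cellCov rows cols S : ℝ) - cellCov rows cols (g j) ≤
      (1 - 1 / (k : ℝ)) ^ j * cellCov rows cols S := by
    intro j
    induction j with
    | zero => simp
    | succ j ih =>
      obtain ⟨h1, h2⟩ := hgreedy j
      rw [← h1] at h2
      have hmono : cellCov rows cols (g j) ≤ cellCov rows cols (g (j + 1)) := by
        rw [h1, cellCov_eq, cellCov_eq]
        exact Finset.card_le_card
          (Finset.biUnion_subset_biUnion_of_subset_left _ (Finset.subset_insert _ _))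
      obtain ⟨m, hm⟩ := Nat.exists_eq_add_of_le hmono
      have h3 := cellCov_step rows cols S (g j) m k hS (fun y => (h2 y).trans hm.le)
      have h3' : (cellCov rows cols S : ℝ) ≤ cellCov rows cols (g j) + k * m := by
        exact_mod_cast h3
      have h4 : ((cellCov rows cols S : ℝ) - cellCov rows cols (g j)) / k ≤ m := by
        rw [div_le_iff₀ (by linarith)]
        linarith
      have h5 := mul_le_mul_of_nonneg_left ih hr
      rw [hm, pow_succ', mul_assoc]
      push_cast
      refine le_trans ?_ h5
      have h6 : (1 - 1 / (k : ℝ)) * ((cellCov rows cols S : ℝ) - cellCov rows cols (g j)) =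
        ((cellCov rows cols S : ℝ) - cellCov rows cols (g j)) -
          ((cellCov rows cols S : ℝ) - cellCov rows cols (g j)) / k := by ring
      rw [h6]
      linarith
  have hexp := Real.one_sub_div_pow_le_exp_neg (n := k) (t := 1) hk'
  have hmul := mul_le_mul_of_nonneg_right hexp (Nat.cast_nonneg (α := ℝ) (cellCov rows cols S))
  have hkk := key k
  constructor <;> linarith
end

section
/- Greedy row selection combined with exhaustive column enumeration achieves a (1 − 1/e) approximation of the optimal k × l sub-table cell coverage: suppose that for every column set U : Finset β with U.card = l, the row set g U : Finset α has cardinality k and is produced by the greedy rule with respect to f_U (starting from ∅, each step inserts a row maximizing f_U after insertion). Then the maximum over all U with U.card = l of (f_U (g U) : ℝ) is at least (1 − Real.exp (−1)) times the maximum, over all U with U.card = l and all S : Finset α with S.card = k, of f_U S. -/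
/-- Column-restricted cell coverage: rule `i` is covered by `(S, U)` iff
`cols i ⊆ U` and `rows i ∩ S` is nonempty; `cellCovU rows cols U S` is the
number of cells described by covered rules. -/
def cellCovU {α β ι : Type*} [Fintype ι] [DecidableEq α] [DecidableEq β] [DecidableEq ι]
    (rows : ι → Finset α) (cols : ι → Finset β) (U : Finset β) (S : Finset α) : ℕ :=
  ((Finset.univ.filter (fun i => cols i ⊆ U ∧ ((rows i) ∩ S).Nonempty)).biUnion
      (fun i => rows i ×ˢ cols i)).card

open Finset in
theorem cov_step_aux {α γ : Type*} [DecidableEq α] [DecidableEq γ]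
    (c : α → Finset γ) (H T : Finset α) (m : ℕ)
    (hm : ∀ y : α, ((insert y H).biUnion c).card ≤ m) :
    (((T.biUnion c).card : ℕ) : ℝ) ≤ ((H.biUnion c).card : ℝ)
      + (T.card : ℝ) * ((m : ℝ) - ((H.biUnion c).card : ℝ)) := by
  have h1 : T.biUnion c ⊆ H.biUnion c ∪ T.biUnion (fun y => c y \ H.biUnion c) := by
    intro z hz
    simp only [mem_union, mem_biUnion, mem_sdiff] at hz ⊢
    obtain ⟨a, ha, hz⟩ := hz
    by_cases hh : ∃ a ∈ H, z ∈ c a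
    · exact Or.inl hh
    · exact Or.inr ⟨a, ha, hz, hh⟩
  have h2 : ∀ y : α, (((c y \ H.biUnion c).card : ℕ) : ℝ) ≤
      (m : ℝ) - ((H.biUnion c).card : ℝ) := by
    intro y
    have h3 := hm y
    rw [biUnion_insert, ← card_sdiff_add_card] at h3
    have h4 : (((c y \ H.biUnion c).card : ℕ) : ℝ) + ((H.biUnion c).card : ℝ) ≤ m := by
      exact_mod_cast h3
    linarith
  have h5 : (T.biUnion c).card ≤ (H.biUnion c).card + ∑ y ∈ T, (c y \ H.biUnion c).card :=
    (card_le_card h1).trans ((card_union_le _ _).trans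
      (Nat.add_le_add_left card_biUnion_le _))
  have h6 : ((T.biUnion c).card : ℝ) ≤
      ((H.biUnion c).card : ℝ) + ∑ y ∈ T, ((c y \ H.biUnion c).card : ℝ) := by
    exact_mod_cast h5
  have h7 : ∑ y ∈ T, ((c y \ H.biUnion c).card : ℝ) ≤
      (T.card : ℝ) * ((m : ℝ) - ((H.biUnion c).card : ℝ)) := by
    have := Finset.sum_le_card_nsmul T (fun y => ((c y \ H.biUnion c).card : ℝ)) _
      (fun y _ => h2 y)
    simpa [nsmul_eq_mul] using this
  linarith

open Finset in
theorem cellCovU_eq_biUnion {α β ι : Type*} [Fintype ι] [DecidableEq α] [DecidableEq β]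
    [DecidableEq ι] (rows : ι → Finset α) (cols : ι → Finset β) (U : Finset β) (S : Finset α) :
    cellCovU rows cols U S = (S.biUnion (fun a =>
      (univ.filter (fun i => cols i ⊆ U ∧ a ∈ rows i)).biUnion
        (fun i => rows i ×ˢ cols i))).card := by
  unfold cellCovU
  congr 1
  ext z
  simp only [mem_biUnion, mem_filter, mem_univ, true_and, Finset.Nonempty, mem_inter]
  constructor
  · rintro ⟨i, ⟨hi, a, ha, hS⟩, hz⟩
    exact ⟨a, hS, i, ⟨hi, ha⟩, hz⟩
  · rintro ⟨a, hS, i, ⟨hi, ha⟩, hz⟩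
    exact ⟨i, ⟨hi, a, ha, hS⟩, hz⟩

theorem greedy_single_aux {α β ι : Type*} [Fintype ι] [DecidableEq α] [DecidableEq β]
    [DecidableEq ι] (rows : ι → Finset α) (cols : ι → Finset β) (k : ℕ) (U : Finset β)
    (h : ℕ → Finset α) (x : ℕ → α)
    (hs : ∀ j : ℕ, h (j + 1) = insert (x j) (h j) ∧
          ∀ y : α, cellCovU rows cols U (insert y (h j)) ≤
            cellCovU rows cols U (insert (x j) (h j)))
    (T : Finset α) (hT : T.card = k) :
    (1 - Real.exp (-1)) * (cellCovU rows cols U T : ℝ) ≤ (cellCovU rows cols U (h k) : ℝ) := by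
  rcases Nat.eq_zero_or_pos k with rfl | hk
  · have : T = ∅ := Finset.card_eq_zero.mp hT
    subst this
    simp [cellCovU]
  have hk' : (1 : ℝ) ≤ k := by exact_mod_cast hk
  have step : ∀ j, (cellCovU rows cols U T : ℝ) ≤ (cellCovU rows cols U (h j) : ℝ)
      + (k : ℝ) * ((cellCovU rows cols U (h (j + 1)) : ℝ) - (cellCovU rows cols U (h j) : ℝ)) := by
    intro j
    obtain ⟨h1, h2⟩ := hs j
    rw [← h1] at h2
    have h3 := cov_step_aux (fun a =>
      (Finset.univ.filter (fun i => cols i ⊆ U ∧ a ∈ rows i)).biUnion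
        (fun i => rows i ×ˢ cols i)) (h j) T (cellCovU rows cols U (h (j + 1)))
      (fun y => by rw [← cellCovU_eq_biUnion]; exact h2 y)
    rw [← cellCovU_eq_biUnion, ← cellCovU_eq_biUnion, hT] at h3
    exact h3
  have hr : (0 : ℝ) ≤ 1 - 1 / k := by
    have : (1 : ℝ) / k ≤ 1 := by rw [div_le_one (by linarith)]; exact hk'
    linarith
  have ind : ∀ j, (cellCovU rows cols U T : ℝ) - (cellCovU rows cols U (h j) : ℝ) ≤
      (1 - 1 / (k : ℝ)) ^ j * (cellCovU rows cols U T : ℝ) := by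
    intro j
    induction j with
    | zero => simp
    | succ j ih =>
      have h1 := step j
      have h2 := mul_le_mul_of_nonneg_left ih hr
      rw [pow_succ']
      refine le_trans ?_ (h2.trans_eq (by ring))
      have h3 : ((cellCovU rows cols U T : ℝ) - (cellCovU rows cols U (h j) : ℝ)) / k ≤
          (cellCovU rows cols U (h (j + 1)) : ℝ) - (cellCovU rows cols U (h j) : ℝ) := by
        rw [div_le_iff₀ (by linarith)]
        linarith
      have h4 : (1 - 1 / (k : ℝ)) *
          ((cellCovU rows cols U T : ℝ) - (cellCovU rows cols U (h j) : ℝ)) =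
          ((cellCovU rows cols U T : ℝ) - (cellCovU rows cols U (h j) : ℝ)) -
          ((cellCovU rows cols U T : ℝ) - (cellCovU rows cols U (h j) : ℝ)) / k := by ring
      rw [h4]
      linarith
  have h5 := ind k
  have h6 : (1 - 1 / (k : ℝ)) ^ k ≤ Real.exp (-1) := Real.one_sub_div_pow_le_exp_neg hk'
  have h7 := mul_le_mul_of_nonneg_right h6 (Nat.cast_nonneg (α := ℝ) (cellCovU rows cols U T))
  linarith

/-- Greedy row selection combined with exhaustive column enumeration achieves a
`(1 - 1/e)` approximation of the optimal `k × l` sub-table cell coverage. -/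
theorem greedy_column_enum_approx {α β ι : Type*} [Fintype α] [Fintype β] [Fintype ι]
    [DecidableEq α] [DecidableEq β] [DecidableEq ι]
    (rows : ι → Finset α) (cols : ι → Finset β) (k l : ℕ)
    (g : Finset β → Finset α)
    (hg : ∀ U : Finset β, U.card = l →
      (g U).card = k ∧
      ∃ (h : ℕ → Finset α) (x : ℕ → α),
        h 0 = ∅ ∧ h k = g U ∧
        ∀ j : ℕ, h (j + 1) = insert (x j) (h j) ∧
          ∀ y : α, cellCovU rows cols U (insert y (h j)) ≤
            cellCovU rows cols U (insert (x j) (h j))) :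
    (((Finset.univ.filter (fun U : Finset β => U.card = l)).sup
        (fun U => cellCovU rows cols U (g U)) : ℕ) : ℝ) ≥
      (1 - Real.exp (-1)) *
        ((((Finset.univ ×ˢ Finset.univ).filter
            (fun p : Finset β × Finset α => p.1.card = l ∧ p.2.card = k)).sup
          (fun p => cellCovU rows cols p.1 p.2) : ℕ) : ℝ) := by
  by_cases hne : ((Finset.univ ×ˢ Finset.univ).filter
            (fun p : Finset β × Finset α => p.1.card = l ∧ p.2.card = k)).Nonempty
  · obtain ⟨p, hp, hpe⟩ := Finset.exists_mem_eq_sup _ hne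
      (fun p : Finset β × Finset α => cellCovU rows cols p.1 p.2)
    rw [hpe]
    obtain ⟨hU, hT⟩ := (Finset.mem_filter.mp hp).2
    obtain ⟨-, h, x, -, hk, hs⟩ := hg p.1 hU
    have h1 := greedy_single_aux rows cols k p.1 h x hs p.2 hT
    rw [hk] at h1
    refine ge_iff_le.mpr (h1.trans ?_)
    have h2 := Finset.le_sup (s := Finset.univ.filter (fun U : Finset β => U.card = l))
      (f := fun U => cellCovU rows cols U (g U)) (b := p.1) (by simp [hU])
    exact_mod_cast h2
  · rw [Finset.not_nonempty_iff_eq_empty.mp hne]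
    simp
end

section
/- Correctness of the reduction from Vertex Cover to maximal cell coverage: for every finite vertex set S : Finset V, the set of cells of T_{G,c} described by rules covered by S equals the set of all non-NULL cells of T_{G,c} — formally, {(v, a) : V × Fin 5 | ∃ e ∈ G.edgeSet, v ∈ e ∧ c e = a ∧ ∃ s ∈ S, s ∈ e} = {(v, a) : V × Fin 5 | ∃ e ∈ G.edgeSet, v ∈ e ∧ c e = a} — if and only if S is a vertex cover of G, i.e., every edge e ∈ G.edgeSet has an endpoint in S. -/
/-- Correctness of the reduction from Vertex Cover to maximal cell coverage:
the set of cells of `T_{G,c}` described by rules covered by `S` equals the set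
of all non-NULL cells of `T_{G,c}` iff `S` is a vertex cover of `G`. -/
theorem vertexCover_iff_cellCover {V : Type*} [Fintype V] [DecidableEq V]
    (G : SimpleGraph V) [DecidableRel G.Adj] (c : Sym2 V → Fin 5)
    (hc : ∀ e ∈ G.edgeSet, ∀ e' ∈ G.edgeSet, e ≠ e' →
      (∃ v : V, v ∈ e ∧ v ∈ e') → c e ≠ c e')
    (S : Finset V) :
    ({p : V × Fin 5 | ∃ e ∈ G.edgeSet, p.1 ∈ e ∧ c e = p.2 ∧ ∃ s ∈ S, s ∈ e} =
      {p : V × Fin 5 | ∃ e ∈ G.edgeSet, p.1 ∈ e ∧ c e = p.2}) ↔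
    (∀ e ∈ G.edgeSet, ∃ s ∈ S, s ∈ e) := by
  constructor
  · intro h e he
    obtain ⟨v, hv⟩ : ∃ v : V, v ∈ e := ⟨_, Sym2.out_fst_mem e⟩
    have hmem : (v, c e) ∈ {p : V × Fin 5 | ∃ e ∈ G.edgeSet, p.1 ∈ e ∧ c e = p.2} :=
      ⟨e, he, hv, rfl⟩
    rw [← h] at hmem
    obtain ⟨e', he', hv', hce, s, hs, hse⟩ := hmem
    by_cases hee : e' = e
    · subst hee
      exact ⟨s, hs, hse⟩
    · exact absurd hce (hc e' he' e he hee ⟨v, hv', hv⟩)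
  · intro h
    ext p
    constructor
    · rintro ⟨e, he, hv, hce, _⟩
      exact ⟨e, he, hv, hce⟩
    · rintro ⟨e, he, hv, hce⟩
      exact ⟨e, he, hv, hce, h e he⟩
end
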